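/- Let A and B be Hermitian operators on (ℂ²)^{⊗n} with Pauli expansions A = ∑_Q a_Q Q and B = ∑_Q b_Q Q, where the sums run over all n-qubit Pauli strings Q and a_Q = 2^{−n} tr(QA), b_Q = 2^{−n} tr(QB) are real. If ψ is a one-local Haar-random product state on n qubits, then E[⟨ψ, Aψ⟩·⟨ψ, Bψ⟩] = a_I b_I + ∑_{Q ≠ I^{⊗n}} a_Q b_Q 3^{−w(Q)}. In particular, if A and B have no common nontrivial Pauli string in their expansions, then the covariance of ⟨ψ, Aψ⟩ and ⟨ψ, Bψ⟩ vanishes, so the corresponding off-diagonal Fisher-information cross terms average to zero. -/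

import Mathlib

open MeasureTheory Matrix

noncomputable section

/-- `SU(2)`: the subgroup of the `2 × 2` complex unitary group consisting of matrices of
determinant `1`. -/
def SU2 : Subgroup (Matrix.unitaryGroup (Fin 2) ℂ) where
  carrier := {U | (U : Matrix (Fin 2) (Fin 2) ℂ).det = 1}
  one_mem' := by simp
  mul_mem' := by
    intro a b ha hb
    simp only [Set.mem_setOf_eq] at *
    rw [Matrix.UnitaryGroup.mul_val, Matrix.det_mul, ha, hb, mul_one]
  inv_mem' := by
    intro a ha
    simp only [Set.mem_setOf_eq] at *
    rw [Matrix.UnitaryGroup.inv_val, Matrix.star_eq_conjTranspose,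
      Matrix.det_conjTranspose, ha, star_one]

/-- The underlying `2 × 2` complex matrix of an element of `SU(2)`. -/
def SU2.mat (U : SU2) : Matrix (Fin 2) (Fin 2) ℂ := U.1.1

/-- The Hermitian inner product `⟨u, v⟩ = ∑ i, conj (u i) * v i`, conjugate-linear in the
first argument. -/
def hInner {ι : Type*} [Fintype ι] (u v : ι → ℂ) : ℂ :=
  ∑ i, starRingEnd ℂ (u i) * v i

/-- The four single-qubit Pauli matrices `I, σ_x, σ_y, σ_z`. -/
def pauli : Fin 4 → Matrix (Fin 2) (Fin 2) ℂ
  | 0 => 1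
  | 1 => !![0, 1; 1, 0]
  | 2 => !![0, -Complex.I; Complex.I, 0]
  | 3 => !![1, 0; 0, -1]

/-- The `n`-qubit Pauli string `τ₁ ⊗ ⋯ ⊗ τₙ`, as a matrix on `(ℂ²)^{⊗n}` (realized as
functions `(Fin n → Fin 2) → ℂ`). -/
def pauliString {n : ℕ} (τ : Fin n → Fin 4) :
    Matrix (Fin n → Fin 2) (Fin n → Fin 2) ℂ :=
  fun x y => ∏ j, pauli (τ j) (x j) (y j)

/-- The elementary tensor `f 1 ⊗ ⋯ ⊗ f n` of single-qubit vectors, as a vector of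
`(ℂ²)^{⊗n}` (realized as functions `(Fin n → Fin 2) → ℂ`). -/
def tensorVec {n : ℕ} (f : (j : Fin n) → Fin 2 → ℂ) : (Fin n → Fin 2) → ℂ :=
  fun x => ∏ j, f j (x j)


/-- The standard basis vector `e₀ = (1,0)ᵀ ∈ ℂ²`. -/
def e0 : Fin 2 → ℂ := fun i => if i = 0 then 1 else 0

/-- The one-local Haar-random product state `ψ = (U₁ ⊗ ⋯ ⊗ Uₙ) e₀^{⊗n}` determined by
`U : Fin n → SU(2)` (the randomness lies in choosing `U` according to the product of Haar
measures). -/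
def spreadState {n : ℕ} (U : Fin n → SU2) : (Fin n → Fin 2) → ℂ :=
  tensorVec fun j => (SU2.mat (U j)).mulVec e0

/-- The weight of an `n`-qubit Pauli string: the number of non-identity tensor factors. -/
def pauliWeight {n : ℕ} (τ : Fin n → Fin 4) : ℕ :=
  (Finset.univ.filter fun j => τ j ≠ 0).card

/-- The (real, for Hermitian `A`) Pauli coefficient `a_Q = 2^{-n}·tr(Q A)` of an operator
`A` on `(ℂ²)^{⊗n}`, so that `A = ∑_Q a_Q Q`. -/
def pauliCoeff {n : ℕ} (A : Matrix (Fin n → Fin 2) (Fin n → Fin 2) ℂ)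
    (τ : Fin n → Fin 4) : ℂ :=
  ((2 : ℂ) ^ n)⁻¹ * (pauliString τ * A).trace

namespace SU2

/-- The element of `SU(2)` with first column `(a, b)`. -/
def ofColumn (a b : ℂ) (h : starRingEnd ℂ a * a + starRingEnd ℂ b * b = 1) : SU2 :=
  ⟨⟨!![a, -starRingEnd ℂ b; b, starRingEnd ℂ a], by
    rw [Matrix.mem_unitaryGroup_iff']
    ext i j
    fin_cases i <;> fin_cases j <;>
      simp [Matrix.mul_apply, Fin.sum_univ_two, Matrix.star_eq_conjTranspose] <;>
      first | ring1 | linear_combination h⟩, by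
    change Matrix.det !![a, -starRingEnd ℂ b; b, starRingEnd ℂ a] = 1
    rw [Matrix.det_fin_two_of]
    linear_combination h⟩

@[simp]
lemma mat_ofColumn (a b : ℂ) (h : starRingEnd ℂ a * a + starRingEnd ℂ b * b = 1) :
    mat (ofColumn a b h) = !![a, -starRingEnd ℂ b; b, starRingEnd ℂ a] := rfl

@[simp]
lemma mat_mul (V U : SU2) : mat (V * U) = mat V * mat U := rfl

lemma continuous_mat_apply (i j : Fin 2) : Continuous fun U : SU2 => mat U i j :=
  (continuous_subtype_val.comp continuous_subtype_val).matrix_elem i j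

lemma norm_mat_apply_le (U : SU2) (i j : Fin 2) : ‖mat U i j‖ ≤ 1 :=
  entry_norm_bound_of_unitary U.1.2 i j

lemma normSq_firstColumn (U : SU2) :
    starRingEnd ℂ (mat U 0 0) * mat U 0 0 + starRingEnd ℂ (mat U 1 0) * mat U 1 0 = 1 := by
  have h : (star (mat U) * mat U) 0 0 = 1 :=
    congrFun₂ (Matrix.mem_unitaryGroup_iff'.1 U.1.2) 0 0
  simpa [Matrix.mul_apply, Fin.sum_univ_two, Matrix.star_eq_conjTranspose] using h

/-- The `k`-th Bloch coordinate `⟨U e₀, σ_k U e₀⟩` of the state `U e₀`, where `σ_0 = I`. -/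
def bloch (U : SU2) (k : Fin 4) : ℂ :=
  hInner ((mat U).mulVec e0) ((pauli k).mulVec ((mat U).mulVec e0))

lemma mulVec_e0 (M : Matrix (Fin 2) (Fin 2) ℂ) (i : Fin 2) : M.mulVec e0 i = M i 0 := by
  simp [Matrix.mulVec, dotProduct, e0]

lemma bloch_zero (U : SU2) : bloch U 0 = 1 := by
  rw [← normSq_firstColumn U]
  simp [bloch, hInner, pauli, e0]

lemma bloch_one (U : SU2) : bloch U 1 =
    starRingEnd ℂ (mat U 0 0) * mat U 1 0 + starRingEnd ℂ (mat U 1 0) * mat U 0 0 := by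
  simp [bloch, hInner, pauli, e0]

lemma bloch_two (U : SU2) : bloch U 2 = Complex.I *
    (starRingEnd ℂ (mat U 1 0) * mat U 0 0 - starRingEnd ℂ (mat U 0 0) * mat U 1 0) := by
  simp [bloch, hInner, pauli, e0]
  ring

lemma bloch_three (U : SU2) : bloch U 3 =
    starRingEnd ℂ (mat U 0 0) * mat U 0 0 - starRingEnd ℂ (mat U 1 0) * mat U 1 0 := by
  simp [bloch, hInner, pauli, e0]
  ring

lemma bloch_sq_sum (U : SU2) : bloch U 1 ^ 2 + bloch U 2 ^ 2 + bloch U 3 ^ 2 = 1 := by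
  rw [bloch_one, bloch_two, bloch_three]
  have h := normSq_firstColumn U
  linear_combination (starRingEnd ℂ (mat U 0 0) * mat U 0 0 +
    starRingEnd ℂ (mat U 1 0) * mat U 1 0 + 1) * h +
    (starRingEnd ℂ (mat U 1 0) * mat U 0 0 - starRingEnd ℂ (mat U 0 0) * mat U 1 0) ^ 2 *
      Complex.I_sq

lemma conj_mulVec_e0_mul_eq_bloch_sum (U : SU2) (x y : Fin 2) :
    starRingEnd ℂ ((mat U).mulVec e0 x) * (mat U).mulVec e0 y =
      ∑ k, 2⁻¹ * (bloch U k * pauli k y x) := by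
  have h : bloch U 0 = starRingEnd ℂ (mat U 0 0) * mat U 0 0 +
      starRingEnd ℂ (mat U 1 0) * mat U 1 0 := by
    rw [bloch_zero, normSq_firstColumn]
  simp only [Fin.sum_univ_four, mulVec_e0, h, bloch_one, bloch_two, bloch_three]
  fin_cases x <;> fin_cases y <;> simp [pauli] <;> ring_nf <;> simp only [Complex.I_sq] <;> ring

lemma continuous_bloch (k : Fin 4) : Continuous fun U : SU2 => bloch U k := by
  simp only [bloch, hInner, Matrix.mulVec, dotProduct]
  have := continuous_mat_apply
  fun_prop

lemma norm_bloch_le (U : SU2) (k : Fin 4) : ‖bloch U k‖ ≤ 2 := by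
  have hp (i j i' j' : Fin 2) : ‖starRingEnd ℂ (mat U i j) * mat U i' j'‖ ≤ 1 := by
    rw [norm_mul, RCLike.norm_conj]
    exact mul_le_one₀ (norm_mat_apply_le ..) (norm_nonneg _) (norm_mat_apply_le ..)
  fin_cases k
  · simp [bloch_zero]
  · simp only [Fin.mk_one, bloch_one]
    exact (norm_add_le _ _).trans (by linarith [hp 0 0 1 0, hp 1 0 0 0])
  · simp only [Fin.reduceFinMk, bloch_two, norm_mul, Complex.norm_I, one_mul]
    exact (norm_sub_le _ _).trans (by linarith [hp 0 0 1 0, hp 1 0 0 0])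
  · simp only [Fin.reduceFinMk, bloch_three]
    exact (norm_sub_le _ _).trans (by linarith [hp 0 0 0 0, hp 1 0 1 0])

/-- The element `i σ_x` of `SU(2)`. -/
def iX : SU2 := ofColumn 0 Complex.I (by simp)

/-- The element `i σ_z` of `SU(2)`. -/
def iZ : SU2 := ofColumn Complex.I 0 (by simp)

/-- The rotation by `2π/3` about the axis `(1,1,1)`, permuting the Bloch axes cyclically. -/
def cyc : SU2 := ofColumn ((1 - Complex.I) / 2) ((1 - Complex.I) / 2) (by
  simp [Complex.conj_ofNat]
  linear_combination (-1 / 2 : ℂ) * Complex.I_sq)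

lemma bloch_iX_mul (U : SU2) (k : Fin 4) :
    bloch (iX * U) k = (![1, 1, -1, -1] : Fin 4 → ℂ) k * bloch U k := by
  fin_cases k <;>
    simp [bloch_zero, bloch_one, bloch_two, bloch_three, iX, Matrix.mul_apply,
      Fin.sum_univ_two] <;> ring_nf <;> simp [Complex.I_sq] <;> ring

lemma bloch_iZ_mul (U : SU2) (k : Fin 4) :
    bloch (iZ * U) k = (![1, -1, -1, 1] : Fin 4 → ℂ) k * bloch U k := by
  fin_cases k <;>
    simp [bloch_zero, bloch_one, bloch_two, bloch_three, iZ, Matrix.mul_apply,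
      Fin.sum_univ_two] <;> ring_nf <;> simp [Complex.I_sq] <;> ring

lemma bloch_cyc_mul_two (U : SU2) : bloch (cyc * U) 2 = bloch U 1 := by
  simp [bloch_one, bloch_two, cyc, Complex.conj_ofNat, Matrix.mul_apply, Fin.sum_univ_two]
  ring_nf
  simp [Complex.I_sq]
  ring

lemma bloch_cyc_mul_three (U : SU2) : bloch (cyc * U) 3 = bloch U 2 := by
  simp [bloch_two, bloch_three, cyc, Complex.conj_ofNat, Matrix.mul_apply, Fin.sum_univ_two]
  ring_nf
  simp [Complex.I_sq]
  ring

section Moments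

variable [MeasurableSpace SU2] [BorelSpace SU2] (μ : Measure SU2)

lemma integrable_bloch_mul [IsFiniteMeasure μ] (k l : Fin 4) :
    Integrable (fun U : SU2 => bloch U k * bloch U l) μ := by
  refine .of_bound ((continuous_bloch k).mul (continuous_bloch l)).measurable.aestronglyMeasurable
    (2 * 2) (.of_forall fun U => ?_)
  rw [norm_mul]
  exact mul_le_mul (norm_bloch_le U k) (norm_bloch_le U l) (norm_nonneg _) zero_le_two

lemma integral_bloch_mul_of_ne [μ.IsHaarMeasure] {k l : Fin 4} (h : k ≠ l) :
    ∫ U : SU2, bloch U k * bloch U l ∂μ = 0 := by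
  have hx := integral_mul_left_eq_self (μ := μ) (fun U : SU2 => bloch U k * bloch U l) iX
  have hz := integral_mul_left_eq_self (μ := μ) (fun U : SU2 => bloch U k * bloch U l) iZ
  simp only [bloch_iX_mul, bloch_iZ_mul, mul_mul_mul_comm, integral_const_mul] at hx hz
  fin_cases k <;> fin_cases l <;> simp_all [neg_eq_self]

lemma integral_bloch_sq [μ.IsHaarMeasure] [IsProbabilityMeasure μ] {k : Fin 4} (h : k ≠ 0) :
    ∫ U : SU2, bloch U k * bloch U k ∂μ = 3⁻¹ := by
  have h₂ := integral_mul_left_eq_self (μ := μ) (fun U : SU2 => bloch U 2 * bloch U 2) cyc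
  have h₃ := integral_mul_left_eq_self (μ := μ) (fun U : SU2 => bloch U 3 * bloch U 3) cyc
  simp only [bloch_cyc_mul_two, bloch_cyc_mul_three] at h₂ h₃
  have hs : ∫ U : SU2, (bloch U 1 * bloch U 1 + bloch U 2 * bloch U 2 + bloch U 3 * bloch U 3) ∂μ
      = 1 := by
    simp [← pow_two, bloch_sq_sum]
  rw [integral_add (by exact (integrable_bloch_mul μ 1 1).add (integrable_bloch_mul μ 2 2))
    (integrable_bloch_mul μ 3 3),
    integral_add (integrable_bloch_mul μ 1 1) (integrable_bloch_mul μ 2 2)] at hs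
  fin_cases k
  · exact absurd rfl h
  · change ∫ U : SU2, bloch U 1 * bloch U 1 ∂μ = 3⁻¹
    linear_combination (1 / 3 : ℂ) * hs + (2 / 3 : ℂ) * h₂ + (1 / 3 : ℂ) * h₃
  · change ∫ U : SU2, bloch U 2 * bloch U 2 ∂μ = 3⁻¹
    linear_combination (1 / 3 : ℂ) * hs - (1 / 3 : ℂ) * h₂ + (1 / 3 : ℂ) * h₃
  · change ∫ U : SU2, bloch U 3 * bloch U 3 ∂μ = 3⁻¹
    linear_combination (1 / 3 : ℂ) * hs - (1 / 3 : ℂ) * h₂ - (2 / 3 : ℂ) * h₃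

lemma integral_bloch_mul [μ.IsHaarMeasure] [IsProbabilityMeasure μ] (k l : Fin 4) :
    ∫ U : SU2, bloch U k * bloch U l ∂μ = if k = l then (if k ≠ 0 then 3⁻¹ else 1) else 0 := by
  split_ifs with hkl hk
  · subst hkl
    exact integral_bloch_sq μ hk
  · obtain rfl : k = 0 := not_not.1 hk
    simp [← hkl, bloch_zero]
  · exact integral_bloch_mul_of_ne μ hkl

lemma integral_prod_bloch_mul [μ.IsHaarMeasure] [IsProbabilityMeasure μ] {n : ℕ}
    (τ ρ : Fin n → Fin 4) :
    ∫ U : Fin n → SU2, (∏ j, bloch (U j) (τ j)) * ∏ j, bloch (U j) (ρ j)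
      ∂(Measure.pi fun _ => μ) = if τ = ρ then ((3 : ℂ) ^ pauliWeight τ)⁻¹ else 0 := by
  simp only [← Finset.prod_mul_distrib]
  rw [integral_fintype_prod_eq_prod fun j (V : SU2) => bloch V (τ j) * bloch V (ρ j)]
  simp only [integral_bloch_mul]
  split_ifs with h
  · subst h
    simp [Finset.prod_ite, pauliWeight]
  · obtain ⟨j, hj⟩ := Function.ne_iff.1 h
    exact Finset.prod_eq_zero (Finset.mem_univ j) (if_neg hj)

lemma integrable_prod_bloch_mul [IsFiniteMeasure μ] {n : ℕ} (τ ρ : Fin n → Fin 4) :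
    Integrable (fun U : Fin n → SU2 => (∏ j, bloch (U j) (τ j)) * ∏ j, bloch (U j) (ρ j))
      (Measure.pi fun _ => μ) := by
  simp only [← Finset.prod_mul_distrib]
  exact Integrable.fintype_prod (f := fun j (V : SU2) => bloch V (τ j) * bloch V (ρ j))
    fun j => integrable_bloch_mul μ (τ j) (ρ j)

end Moments

end SU2

lemma conj_spreadState_mul {n : ℕ} (U : Fin n → SU2) (x y : Fin n → Fin 2) :
    starRingEnd ℂ (spreadState U x) * spreadState U y =
      ∑ τ : Fin n → Fin 4, ((2 : ℂ) ^ n)⁻¹ * ((∏ j, SU2.bloch (U j) (τ j)) * pauliString τ y x) := by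
  simp only [spreadState, tensorVec, map_prod, ← Finset.prod_mul_distrib,
    SU2.conj_mulVec_e0_mul_eq_bloch_sum, Finset.prod_univ_sum, Fintype.piFinset_univ]
  simp [Finset.prod_mul_distrib, pauliString]

lemma hInner_spreadState_mulVec {n : ℕ} (A : Matrix (Fin n → Fin 2) (Fin n → Fin 2) ℂ)
    (U : Fin n → SU2) :
    hInner (spreadState U) (A.mulVec (spreadState U)) =
      ∑ τ : Fin n → Fin 4, pauliCoeff A τ * ∏ j, SU2.bloch (U j) (τ j) := by
  calc hInner (spreadState U) (A.mulVec (spreadState U))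
      = ∑ x, ∑ y, A x y * (starRingEnd ℂ (spreadState U x) * spreadState U y) := by
        simp only [hInner, Matrix.mulVec, dotProduct, Finset.mul_sum]
        exact Finset.sum_congr rfl fun x _ => Finset.sum_congr rfl fun y _ => by ring
    _ = ∑ y, ∑ x, ∑ τ : Fin n → Fin 4, A x y *
          (((2 : ℂ) ^ n)⁻¹ * ((∏ j, SU2.bloch (U j) (τ j)) * pauliString τ y x)) := by
        rw [Finset.sum_comm]
        simp only [conj_spreadState_mul, Finset.mul_sum]
    _ = ∑ τ : Fin n → Fin 4, ∑ y, ∑ x, A x y *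
          (((2 : ℂ) ^ n)⁻¹ * ((∏ j, SU2.bloch (U j) (τ j)) * pauliString τ y x)) := by
        exact (Finset.sum_congr rfl fun y _ => Finset.sum_comm).trans Finset.sum_comm
    _ = ∑ τ : Fin n → Fin 4, pauliCoeff A τ * ∏ j, SU2.bloch (U j) (τ j) := by
        refine Finset.sum_congr rfl fun τ _ => ?_
        simp only [pauliCoeff, Matrix.trace, Matrix.diag, Matrix.mul_apply, Finset.mul_sum,
          Finset.sum_mul]
        exact Finset.sum_congr rfl fun y _ => Finset.sum_congr rfl fun x _ => by ring

/-- For Hermitian operators `A, B` on `(ℂ²)^{⊗n}` with Pauli coefficients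
`a_Q = 2^{-n} tr(QA)`, `b_Q = 2^{-n} tr(QB)` and a one-local Haar-random product state
`ψ`, `E[⟨ψ, Aψ⟩·⟨ψ, Bψ⟩] = a_I b_I + ∑_{Q ≠ I^{⊗n}} a_Q b_Q 3^{-w(Q)}`; in particular if
`A` and `B` share no common nontrivial Pauli string, the covariance of `⟨ψ, Aψ⟩` and
`⟨ψ, Bψ⟩` vanishes. -/
theorem haar_quadratic_form_covariance [MeasurableSpace SU2] [BorelSpace SU2]
    (μ : Measure SU2) [μ.IsHaarMeasure] [IsProbabilityMeasure μ]
    (n : ℕ) (A B : Matrix (Fin n → Fin 2) (Fin n → Fin 2) ℂ)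
    (hA : A.IsHermitian) (hB : B.IsHermitian) :
    (∫ U : Fin n → SU2,
        hInner (spreadState U) (A.mulVec (spreadState U)) *
          hInner (spreadState U) (B.mulVec (spreadState U))
        ∂(Measure.pi fun _ : Fin n => μ))
      = pauliCoeff A (fun _ => 0) * pauliCoeff B (fun _ => 0) +
        ∑ τ ∈ Finset.univ.filter fun τ : Fin n → Fin 4 => τ ≠ fun _ => 0,
          pauliCoeff A τ * pauliCoeff B τ * ((3 : ℂ) ^ pauliWeight τ)⁻¹ := by
  simp only [hInner_spreadState_mulVec, Finset.sum_mul_sum, mul_mul_mul_comm]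
  rw [integral_finsetSum _ fun τ _ => integrable_finsetSum _ fun ρ _ =>
    (SU2.integrable_prod_bloch_mul μ τ ρ).const_mul _]
  have key (τ : Fin n → Fin 4) :
      ∫ U : Fin n → SU2, ∑ ρ : Fin n → Fin 4, pauliCoeff A τ * pauliCoeff B ρ *
        ((∏ j, SU2.bloch (U j) (τ j)) * ∏ j, SU2.bloch (U j) (ρ j)) ∂(Measure.pi fun _ => μ) =
      pauliCoeff A τ * pauliCoeff B τ * ((3 : ℂ) ^ pauliWeight τ)⁻¹ := by
    rw [integral_finsetSum _ fun ρ _ => (SU2.integrable_prod_bloch_mul μ τ ρ).const_mul _]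
    simp [integral_const_mul, SU2.integral_prod_bloch_mul]
  simp only [key, Finset.filter_ne']
  rw [← Finset.add_sum_erase _ _ (Finset.mem_univ fun _ => 0)]
  simp [pauliWeight]

end
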